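/- Let (F^•, E^•, I^•, Ψ) be a homological spark complex with cone complex (G^•, D), and let k ≥ 0. Every D-closed element (a,r) ∈ G^k is a spark of degree k (with smooth part e = 0), and the assignment sending a D-closed element to its spark class induces a well-defined injective group homomorphism H^k(G) → Ĥ^k whose image equals ker(δ₁). Consequently the sequence 0 → H^k(G) → Ĥ^k →(δ₁)→ Z_I^{k+1}(E) → 0 is exact. -/

import Mathlib

universe u

/-- A homological spark complex: cochain complexes `F`, `E ⊆ F`, `I` (indexed by `ℤ`,
trivial in negative degrees), a morphism `Ψ : I → F`, such that `Ψ(Iᵏ) ∩ Eᵏ = 0` for `k > 0`,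
the inclusion `E ⊆ F` induces an isomorphism on cohomology, and `Ψ` is injective in degree 0. -/
structure SparkComplex where
  F : ℤ → Type u
  [instF : ∀ n, AddCommGroup (F n)]
  I : ℤ → Type u
  [instI : ∀ n, AddCommGroup (I n)]
  dF : ∀ n, F n →+ F (n + 1)
  dI : ∀ n, I n →+ I (n + 1)
  E : ∀ n, AddSubgroup (F n)
  Ψ : ∀ n, I n →+ F n
  F_neg : ∀ n < 0, Subsingleton (F n)
  I_neg : ∀ n < 0, Subsingleton (I n)
  dF_sq : ∀ n (a : F n), dF (n + 1) (dF n a) = 0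
  dI_sq : ∀ n (r : I n), dI (n + 1) (dI n r) = 0
  E_stable : ∀ n, ∀ a ∈ E n, dF n a ∈ E (n + 1)
  Ψ_comm : ∀ n (r : I n), dF n (Ψ n r) = Ψ (n + 1) (dI n r)
  disj : ∀ n, 0 < n → ∀ r : I n, Ψ n r ∈ E n → Ψ n r = 0
  psi0_inj : ∀ r : I 0, Ψ 0 r = 0 → r = 0
  h_surj : ∀ n (a : F (n + 1)), dF (n + 1) a = 0 →
    ∃ e ∈ E (n + 1), ∃ b : F n, a = e + dF n b
  h_inj : ∀ n (e : F (n + 1)), e ∈ E (n + 1) → dF (n + 1) e = 0 →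
    (∃ b : F n, e = dF n b) → ∃ c ∈ E n, e = dF n c

attribute [instance] SparkComplex.instF SparkComplex.instI

namespace SparkComplex

variable (S : SparkComplex)

/-- Transport along an equality of degrees, for `F`. -/
def fcast {m n : ℤ} (h : m = n) : S.F m →+ S.F n := by subst h; exact AddMonoidHom.id _

/-- Transport along an equality of degrees, for `I`. -/
def icast {m n : ℤ} (h : m = n) : S.I m →+ S.I n := by subst h; exact AddMonoidHom.id _

/-- The differential of `F` written as a map `F^(k-1) → F^k`. -/
def dF' (k : ℤ) : S.F (k - 1) →+ S.F k := (S.fcast (by omega)).comp (S.dF (k - 1))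

/-- The differential of `I` written as a map `I^(k-1) → I^k`. -/
def dI' (k : ℤ) : S.I (k - 1) →+ S.I k := (S.icast (by omega)).comp (S.dI (k - 1))

/-- A spark of degree `k` : a pair `(a, r) ∈ F^k ⊕ I^(k+1)` with `dr = 0` and
`da = e - Ψ(r)` for some `e ∈ E^(k+1)`. -/
def IsSpark (k : ℤ) (p : S.F k × S.I (k + 1)) : Prop :=
  S.dI (k + 1) p.2 = 0 ∧ ∃ e ∈ S.E (k + 1), S.dF k p.1 = e - S.Ψ (k + 1) p.2

/-- Equivalence of sparks of degree `k`. -/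
def SparkEquiv (k : ℤ) (p q : S.F k × S.I (k + 1)) : Prop :=
  ∃ (b : S.F (k - 1)) (s : S.I k),
    p.1 - q.1 = S.dF' k b + S.Ψ k s ∧ p.2 - q.2 = -S.dI k s

/-- The group of sparks of degree `k`. -/
def sparkGroup (k : ℤ) : AddSubgroup (S.F k × S.I (k + 1)) where
  carrier := {p | S.IsSpark k p}
  zero_mem' := by
    simp only [Set.mem_setOf_eq, IsSpark]
    exact ⟨by simp, 0, zero_mem _, by simp⟩
  add_mem' := by
    intro p q hp hq
    simp only [Set.mem_setOf_eq, IsSpark] at hp hq ⊢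
    obtain ⟨hp1, e, he, hpe⟩ := hp
    obtain ⟨hq1, e', he', hqe⟩ := hq
    refine ⟨?_, e + e', add_mem he he', ?_⟩
    · rw [Prod.snd_add, map_add, hp1, hq1, add_zero]
    · rw [Prod.fst_add, Prod.snd_add, map_add, map_add, hpe, hqe]; try abel
  neg_mem' := by
    intro p hp
    simp only [Set.mem_setOf_eq, IsSpark] at hp ⊢
    obtain ⟨hp1, e, he, hpe⟩ := hp
    refine ⟨?_, -e, neg_mem he, ?_⟩
    · rw [Prod.snd_neg, map_neg, hp1, neg_zero]
    · rw [Prod.fst_neg, Prod.snd_neg, map_neg, map_neg, hpe]; try abel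

/-- The group of sparks equivalent to zero. -/
def trivGroup (k : ℤ) : AddSubgroup (S.F k × S.I (k + 1)) where
  carrier := {p | ∃ (b : S.F (k - 1)) (s : S.I k),
    p.1 = S.dF' k b + S.Ψ k s ∧ p.2 = -S.dI k s}
  zero_mem' := by
    simp only [Set.mem_setOf_eq]
    exact ⟨0, 0, by simp, by simp⟩
  add_mem' := by
    intro p q hp hq
    simp only [Set.mem_setOf_eq] at hp hq ⊢
    obtain ⟨b, s, h1, h2⟩ := hp
    obtain ⟨b', s', h1', h2'⟩ := hq
    refine ⟨b + b', s + s', ?_, ?_⟩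
    · rw [Prod.fst_add, map_add, map_add, h1, h1']; try abel
    · rw [Prod.snd_add, map_add, h2, h2']; try abel
  neg_mem' := by
    intro p hp
    simp only [Set.mem_setOf_eq] at hp ⊢
    obtain ⟨b, s, h1, h2⟩ := hp
    refine ⟨-b, -s, ?_, ?_⟩
    · rw [Prod.fst_neg, map_neg, map_neg, h1]; try abel
    · rw [Prod.snd_neg, map_neg, h2]; try abel

/-- The group `Ĥᵏ` of spark classes of degree `k`. -/
def hhat (k : ℤ) : Type u :=
  ↥(S.sparkGroup k) ⧸ (S.trivGroup k).addSubgroupOf (S.sparkGroup k)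

instance (k : ℤ) : AddCommGroup (S.hhat k) :=
  inferInstanceAs (AddCommGroup
    (↥(S.sparkGroup k) ⧸ (S.trivGroup k).addSubgroupOf (S.sparkGroup k)))

/-- The spark class of a spark. -/
def mkSpark (k : ℤ) (p : S.F k × S.I (k + 1)) (h : S.IsSpark k p) : S.hhat k :=
  QuotientAddGroup.mk (⟨p, h⟩ : ↥(S.sparkGroup k))

/-- Cocycles of `I`. -/
def zI (k : ℤ) : AddSubgroup (S.I k) where
  carrier := {r | S.dI k r = 0}
  zero_mem' := by simp
  add_mem' := by
    intro a b ha hb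
    simp only [Set.mem_setOf_eq] at ha hb ⊢
    rw [map_add, ha, hb, add_zero]
  neg_mem' := by
    intro a ha
    simp only [Set.mem_setOf_eq] at ha ⊢
    rw [map_neg, ha, neg_zero]

/-- Coboundaries of `I`. -/
def bI (k : ℤ) : AddSubgroup (S.I k) := (S.dI' k).range

/-- Cohomology of `I`. -/
def HI (k : ℤ) : Type u := ↥(S.zI k) ⧸ (S.bI k).addSubgroupOf (S.zI k)

instance (k : ℤ) : AddCommGroup (S.HI k) :=
  inferInstanceAs (AddCommGroup (↥(S.zI k) ⧸ (S.bI k).addSubgroupOf (S.zI k)))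

/-- The cohomology class of a cocycle of `I`. -/
def mkHI (k : ℤ) (r : S.I k) (h : S.dI k r = 0) : S.HI k :=
  QuotientAddGroup.mk (⟨r, h⟩ : ↥(S.zI k))

/-- Cocycles of `F`. -/
def zF (k : ℤ) : AddSubgroup (S.F k) where
  carrier := {a | S.dF k a = 0}
  zero_mem' := by simp
  add_mem' := by
    intro a b ha hb
    simp only [Set.mem_setOf_eq] at ha hb ⊢
    rw [map_add, ha, hb, add_zero]
  neg_mem' := by
    intro a ha
    simp only [Set.mem_setOf_eq] at ha ⊢
    rw [map_neg, ha, neg_zero]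

/-- Coboundaries of `F`. -/
def bF (k : ℤ) : AddSubgroup (S.F k) := (S.dF' k).range

/-- Cohomology of `F`. -/
def HF (k : ℤ) : Type u := ↥(S.zF k) ⧸ (S.bF k).addSubgroupOf (S.zF k)

instance (k : ℤ) : AddCommGroup (S.HF k) :=
  inferInstanceAs (AddCommGroup (↥(S.zF k) ⧸ (S.bF k).addSubgroupOf (S.zF k)))

/-- The cohomology class of a cocycle of `F`. -/
def mkHF (k : ℤ) (a : S.F k) (h : S.dF k a = 0) : S.HF k :=
  QuotientAddGroup.mk (⟨a, h⟩ : ↥(S.zF k))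

/-- The group `Z_I^k(E)` of `d`-closed elements of `E^k` whose cohomology class (in
`H^k(E) ≅ H^k(F)`) lies in the image of `Ψ_* : H^k(I) → H^k(F)`. -/
def ZIE (k : ℤ) : AddSubgroup (S.F k) where
  carrier := {e | e ∈ S.E k ∧ S.dF k e = 0 ∧
    ∃ r : S.I k, S.dI k r = 0 ∧ ∃ b : S.F (k - 1), e - S.Ψ k r = S.dF' k b}
  zero_mem' := by
    simp only [Set.mem_setOf_eq]
    refine ⟨zero_mem _, map_zero _, 0, map_zero _, 0, by simp⟩
  add_mem' := by
    intro a b ha hb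
    simp only [Set.mem_setOf_eq] at ha hb ⊢
    obtain ⟨haE, had, r, hr, c, hc⟩ := ha
    obtain ⟨hbE, hbd, r', hr', c', hc'⟩ := hb
    refine ⟨add_mem haE hbE, by rw [map_add, had, hbd, add_zero], r + r',
      by rw [map_add, hr, hr', add_zero], c + c', ?_⟩
    rw [map_add, map_add, ← hc, ← hc']
    abel
  neg_mem' := by
    intro a ha
    simp only [Set.mem_setOf_eq] at ha ⊢
    obtain ⟨haE, had, r, hr, c, hc⟩ := ha
    refine ⟨neg_mem haE, by rw [map_neg, had, neg_zero], -r,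
      by rw [map_neg, hr, neg_zero], -c, ?_⟩
    rw [map_neg, map_neg, ← hc]
    abel

/-- The differential of the cone complex `G^k = F^k ⊕ I^(k+1)`,
`D(a,r) = (da + Ψ(r), -dr)`. -/
def coneD (k : ℤ) : (S.F k × S.I (k + 1)) →+ (S.F (k + 1) × S.I (k + 1 + 1)) :=
  AddMonoidHom.mk' (fun p => (S.dF k p.1 + S.Ψ (k + 1) p.2, -(S.dI (k + 1) p.2)))
    (by
      intro p q
      simp only [Prod.fst_add, Prod.snd_add, map_add, Prod.mk_add_mk, Prod.mk.injEq]
      exact ⟨by abel, by abel⟩)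

/-- Transport along an equality of degrees, for the cone complex. -/
def gcast {m n : ℤ} (h : m = n) : (S.F m × S.I (m + 1)) →+ (S.F n × S.I (n + 1)) := by
  subst h; exact AddMonoidHom.id _

/-- The cone differential written as a map `G^(k-1) → G^k`. -/
def coneD' (k : ℤ) : (S.F (k - 1) × S.I (k - 1 + 1)) →+ (S.F k × S.I (k + 1)) :=
  (S.gcast (by omega)).comp (S.coneD (k - 1))

/-- Cocycles of the cone complex. -/
def zG (k : ℤ) : AddSubgroup (S.F k × S.I (k + 1)) where
  carrier := {p | S.coneD k p = 0}
  zero_mem' := by simp only [Set.mem_setOf_eq, map_zero]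
  add_mem' := by
    intro p q hp hq
    simp only [Set.mem_setOf_eq] at hp hq ⊢
    rw [map_add, hp, hq, add_zero]
  neg_mem' := by
    intro p hp
    simp only [Set.mem_setOf_eq] at hp ⊢
    rw [map_neg, hp, neg_zero]

/-- Coboundaries of the cone complex. -/
def bG (k : ℤ) : AddSubgroup (S.F k × S.I (k + 1)) := (S.coneD' k).range

/-- Cohomology `H^k(G)` of the cone complex. -/
def HG (k : ℤ) : Type u := ↥(S.zG k) ⧸ (S.bG k).addSubgroupOf (S.zG k)

instance (k : ℤ) : AddCommGroup (S.HG k) :=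
  inferInstanceAs (AddCommGroup (↥(S.zG k) ⧸ (S.bG k).addSubgroupOf (S.zG k)))

/-- The cohomology class of a cocycle of the cone complex. -/
def mkHG (k : ℤ) (p : S.F k × S.I (k + 1)) (h : S.coneD k p = 0) : S.HG k :=
  QuotientAddGroup.mk (⟨p, h⟩ : ↥(S.zG k))

/-- Cocycles of `E`. -/
def zE (k : ℤ) : AddSubgroup (S.F k) where
  carrier := {a | a ∈ S.E k ∧ S.dF k a = 0}
  zero_mem' := by
    simp only [Set.mem_setOf_eq]
    exact ⟨zero_mem _, map_zero _⟩
  add_mem' := by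
    intro a b ha hb
    simp only [Set.mem_setOf_eq] at ha hb ⊢
    exact ⟨add_mem ha.1 hb.1, by rw [map_add, ha.2, hb.2, add_zero]⟩
  neg_mem' := by
    intro a ha
    simp only [Set.mem_setOf_eq] at ha ⊢
    exact ⟨neg_mem ha.1, by rw [map_neg, ha.2, neg_zero]⟩

/-- Coboundaries of `E`. -/
def bE (k : ℤ) : AddSubgroup (S.F k) := AddSubgroup.map (S.dF' k) (S.E (k - 1))

/-- Cohomology `H^k(E)` of `E`. -/
def HE (k : ℤ) : Type u := ↥(S.zE k) ⧸ (S.bE k).addSubgroupOf (S.zE k)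

instance (k : ℤ) : AddCommGroup (S.HE k) :=
  inferInstanceAs (AddCommGroup (↥(S.zE k) ⧸ (S.bE k).addSubgroupOf (S.zE k)))

/-- The image `H^k_I(E)` of `Ψ_* : H^k(I) → H^k(E)` in `H^k(E)`. -/
def HIE (k : ℤ) : AddSubgroup (S.HE k) :=
  AddSubgroup.map (QuotientAddGroup.mk' ((S.bE k).addSubgroupOf (S.zE k)))
    ((S.ZIE k).addSubgroupOf (S.zE k))

/-- The subgroup `dE^k ⊆ F^(k+1)`. -/
def dimE (k : ℤ) : AddSubgroup (S.F (k + 1)) := AddSubgroup.map (S.dF k) (S.E k)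

end SparkComplex

namespace SparkComplex

variable (S : SparkComplex)

theorem dF_fcast {m n : ℤ} (h : m = n) (h' : m + 1 = n + 1) (a : S.F m) :
    S.dF n (S.fcast h a) = S.fcast h' (S.dF m a) := by
  subst h; rfl

theorem dF_fcast_dF {m n : ℤ} (h : m + 1 = n) (b : S.F m) :
    S.dF n (S.fcast h (S.dF m b)) = 0 := by
  subst h; exact S.dF_sq m b

theorem dF_dF' (k : ℤ) (b : S.F (k - 1)) : S.dF k (S.dF' k b) = 0 :=
  S.dF_fcast_dF _ b

theorem dF'_succ (k : ℤ) (b : S.F (k + 1 - 1)) :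
    S.dF' (k + 1) b = S.dF k (S.fcast (by omega) b) :=
  (S.dF_fcast (by omega) (by omega) b).symm

theorem fcast_fcast {m n : ℤ} (h : m = n) (h' : n = m) (a : S.F n) :
    S.fcast h (S.fcast h' a) = a := by
  subst h; rfl

theorem icast_icast {m n : ℤ} (h : m = n) (h' : n = m) (s : S.I n) :
    S.icast h (S.icast h' s) = s := by
  subst h; rfl

theorem gcast_coneD {m n : ℤ} (h : m + 1 = n) (p : S.F m × S.I (m + 1)) :
    S.gcast h (S.coneD m p) =
      (S.fcast h (S.dF m p.1) + S.Ψ n (S.icast h p.2), -S.dI n (S.icast h p.2)) := by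
  subst h; rfl

theorem coneD'_apply (k : ℤ) (p : S.F (k - 1) × S.I (k - 1 + 1)) :
    S.coneD' k p = (S.dF' k p.1 + S.Ψ k (S.icast (by omega) p.2),
      -S.dI k (S.icast (by omega) p.2)) :=
  S.gcast_coneD _ p

/-- The spark equivalence relation is cohomology in the cone complex. -/
theorem bG_eq_trivGroup (k : ℤ) : S.bG k = S.trivGroup k := by
  ext p
  constructor
  · rintro ⟨q, rfl⟩
    rw [coneD'_apply]
    exact ⟨q.1, _, rfl, rfl⟩
  · rintro ⟨b, s, h₁, h₂⟩
    refine ⟨(b, S.icast (by omega) s), ?_⟩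
    rw [coneD'_apply, icast_icast]
    exact Prod.ext h₁.symm h₂.symm

theorem mem_zG {k : ℤ} {p : S.F k × S.I (k + 1)} :
    p ∈ S.zG k ↔ S.dF k p.1 + S.Ψ (k + 1) p.2 = 0 ∧ S.dI (k + 1) p.2 = 0 := by
  change (S.dF k p.1 + S.Ψ (k + 1) p.2, -(S.dI (k + 1) p.2)) = 0 ↔ _
  rw [Prod.mk_eq_zero, neg_eq_zero]

theorem dF_eq_zero_sub_of_mem_zG {k : ℤ} {p : S.F k × S.I (k + 1)} (h : p ∈ S.zG k) :
    S.dF k p.1 = 0 - S.Ψ (k + 1) p.2 := by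
  rw [zero_sub]
  exact eq_neg_of_add_eq_zero_left (S.mem_zG.1 h).1

theorem zG_le_sparkGroup (k : ℤ) : S.zG k ≤ S.sparkGroup k := fun _ h =>
  ⟨(S.mem_zG.1 h).2, 0, zero_mem _, S.dF_eq_zero_sub_of_mem_zG h⟩

/-- The homomorphism `H^k(G) → Ĥ^k` sending the class of a cocycle to its spark class. -/
def coneToSpark (k : ℤ) : S.HG k →+ S.hhat k :=
  QuotientAddGroup.map ((S.bG k).addSubgroupOf (S.zG k))
    ((S.trivGroup k).addSubgroupOf (S.sparkGroup k))
    (AddSubgroup.inclusion (S.zG_le_sparkGroup k))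
    (fun _ h => (S.bG_eq_trivGroup k).le h)

theorem coneToSpark_injective (k : ℤ) : Function.Injective (S.coneToSpark k) := by
  rw [injective_iff_map_eq_zero]
  intro x hx
  obtain ⟨p, rfl⟩ := QuotientAddGroup.mk_surjective x
  have h := (QuotientAddGroup.eq_zero_iff (AddSubgroup.inclusion (S.zG_le_sparkGroup k) p)).1 hx
  exact (QuotientAddGroup.eq_zero_iff p).2 ((S.bG_eq_trivGroup k).ge h)

theorem dF_add_mem_ZIE {k : ℤ} {p : S.F k × S.I (k + 1)} (h : S.IsSpark k p) :
    S.dF k p.1 + S.Ψ (k + 1) p.2 ∈ S.ZIE (k + 1) := by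
  obtain ⟨hr, e, he, hda⟩ := h
  refine ⟨?_, ?_, p.2, hr, S.fcast (by omega) p.1, ?_⟩
  · rwa [hda, sub_add_cancel]
  · rw [map_add, dF_sq, Ψ_comm, hr, map_zero, add_zero]
  · rw [add_sub_cancel_right]
    rw [dF'_succ, fcast_fcast]

/-- The smooth part `e = da + Ψ(r)` of a spark `(a, r)`. -/
def smoothPart (k : ℤ) : ↥(S.sparkGroup k) →+ ↥(S.ZIE (k + 1)) :=
  AddMonoidHom.mk' (fun p => ⟨S.dF k p.1.1 + S.Ψ (k + 1) p.1.2, S.dF_add_mem_ZIE p.2⟩) <| by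
    intro p q
    ext
    simp only [AddSubgroup.coe_add, Prod.fst_add, Prod.snd_add, map_add]
    abel

theorem trivGroup_le_ker_smoothPart (k : ℤ) :
    (S.trivGroup k).addSubgroupOf (S.sparkGroup k) ≤ (S.smoothPart k).ker := by
  rintro ⟨p, hp⟩ ⟨b, s, h₁, h₂⟩
  refine Subtype.ext (?_ : S.dF k p.1 + S.Ψ (k + 1) p.2 = 0)
  have h₁' : p.1 = S.dF' k b + S.Ψ k s := h₁
  have h₂' : p.2 = -S.dI k s := h₂
  rw [h₁', h₂', map_add, dF_dF', Ψ_comm, map_neg, zero_add, add_neg_cancel]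

/-- The homomorphism `δ₁ : Ĥ^k → Z_I^(k+1)(E)`. -/
def delta (k : ℤ) : S.hhat k →+ ↥(S.ZIE (k + 1)) :=
  QuotientAddGroup.lift _ (S.smoothPart k) (S.trivGroup_le_ker_smoothPart k)

theorem coe_delta_mkSpark {k : ℤ} {p : S.F k × S.I (k + 1)} (hp : S.IsSpark k p) :
    (S.delta k (S.mkSpark k p hp) : S.F (k + 1)) = S.dF k p.1 + S.Ψ (k + 1) p.2 := rfl

theorem range_coneToSpark (k : ℤ) : (S.coneToSpark k).range = (S.delta k).ker := by
  ext x
  constructor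
  · rintro ⟨y, rfl⟩
    obtain ⟨p, rfl⟩ := QuotientAddGroup.mk_surjective y
    exact Subtype.ext (S.mem_zG.1 p.2).1
  · intro hx
    obtain ⟨⟨p, hp⟩, rfl⟩ := QuotientAddGroup.mk_surjective x
    have h : S.dF k p.1 + S.Ψ (k + 1) p.2 = 0 := congrArg Subtype.val hx
    exact ⟨S.mkHG k p (S.mem_zG.2 ⟨h, hp.1⟩), rfl⟩

theorem delta_surjective (k : ℤ) : Function.Surjective (S.delta k) := by
  rintro ⟨e, he, hde, r, hr, b, hb⟩
  rw [dF'_succ] at hb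
  have hs : S.IsSpark k (S.fcast (by omega) b, r) :=
    ⟨hr, e, he, hb.symm⟩
  refine ⟨S.mkSpark k _ hs, Subtype.ext ?_⟩
  rw [coe_delta_mkSpark, ← hb, sub_add_cancel]

end SparkComplex

/-- every `D`-closed element of the cone complex `G^k` is a spark with smooth
part `0`, and `[(a,r)] ↦ class of (a,r)` gives an injective homomorphism `H^k(G) → Ĥ^k`
with image `ker δ₁`; hence `0 → H^k(G) → Ĥ^k → Z_I^(k+1)(E) → 0` is exact. -/
theorem cone_cohomology_into_sparks (S : SparkComplex) (k : ℤ) (hk : 0 ≤ k) :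
    (∀ p : S.F k × S.I (k + 1), S.coneD k p = 0 →
      S.IsSpark k p ∧ S.dF k p.1 = 0 - S.Ψ (k + 1) p.2) ∧
    ∃ (ι : S.HG k →+ S.hhat k) (δ₁ : S.hhat k →+ ↥(S.ZIE (k + 1))),
      (∀ (p : S.F k × S.I (k + 1)) (hD : S.coneD k p = 0) (hs : S.IsSpark k p),
        ι (S.mkHG k p hD) = S.mkSpark k p hs) ∧
      (∀ (p : S.F k × S.I (k + 1)) (hp : S.IsSpark k p) (e : S.F (k + 1)),
        e ∈ S.E (k + 1) → S.dF k p.1 = e - S.Ψ (k + 1) p.2 →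
        ((δ₁ (S.mkSpark k p hp) : S.F (k + 1)) = e)) ∧
      Function.Injective ι ∧ ι.range = δ₁.ker ∧ Function.Surjective δ₁ := by
  refine ⟨fun p hp => ⟨S.zG_le_sparkGroup k hp, S.dF_eq_zero_sub_of_mem_zG hp⟩,
    S.coneToSpark k, S.delta k, fun _ _ _ => rfl, ?_, S.coneToSpark_injective k,
    S.range_coneToSpark k, S.delta_surjective k⟩
  intro p hp e _ hda
  rw [S.coe_delta_mkSpark hp, hda, sub_add_cancel]
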